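/- Let n ≥ 1 and let f : (Fin n → Bool) → Bool be a feedback function. Then the n-stage Fibonacci FSR with feedback f has exactly 2^n distinct output sequences: Nat.card (Set.range (fun x₀ => outF f x₀)) = 2^n. -/

import Mathlib

/-- The Fibonacci transition map `F_f` of an `n`-stage FSR with feedback function `f`:
`(F_f x) i = x (i+1)` when `(i : ℕ) + 1 < n`, and `(F_f x) i = f x` when `(i : ℕ) + 1 = n`. -/
def fibStep (n : ℕ) (f : (Fin n → Bool) → Bool) (x : Fin n → Bool) : Fin n → Bool :=
  fun i => if h : (i : ℕ) + 1 < n then x ⟨(i : ℕ) + 1, h⟩ else f x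

/-- The output sequence of the `n`-stage Fibonacci FSR with feedback `f` from initial state `x₀`. -/
def outF (n : ℕ) (hn : 0 < n) (f : (Fin n → Bool) → Bool) (x₀ : Fin n → Bool) (t : ℕ) : Bool :=
  (fibStep n f)^[t] x₀ ⟨0, hn⟩

/-- The output sequence of an `n`-stage (Galois) FSR with transition map `G` from initial state `z₀`. -/
def outG (n : ℕ) (hn : 0 < n) (G : (Fin n → Bool) → (Fin n → Bool)) (z₀ : Fin n → Bool) (t : ℕ) : Bool :=
  (G^[t] z₀) ⟨0, hn⟩

theorem fibStep_iterate_apply (n : ℕ) (f : (Fin n → Bool) → Bool) (x : Fin n → Bool)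
    (t i : ℕ) (h : i + t < n) :
    (fibStep n f)^[t] x ⟨i, by omega⟩ = x ⟨i + t, h⟩ := by
  induction t generalizing i with
  | zero => rfl
  | succ t ih =>
    rw [Function.iterate_succ_apply', fibStep, dif_pos (by simp only; omega), ih (i + 1) (by omega)]
    congr 2
    omega

theorem outF_apply_fin (n : ℕ) (hn : 0 < n) (f : (Fin n → Bool) → Bool) (x : Fin n → Bool)
    (i : Fin n) : outF n hn f x i = x i := by
  simp [outF, fibStep_iterate_apply n f x i 0 (by omega)]

theorem outF_injective (n : ℕ) (hn : 0 < n) (f : (Fin n → Bool) → Bool) :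
    Function.Injective (outF n hn f) := fun x y h => by
  ext1 i
  rw [← outF_apply_fin n hn f x i, h, outF_apply_fin]

/-- An `n`-stage Fibonacci FSR has exactly `2^n` distinct output sequences. -/
theorem fibonacci_output_card (n : ℕ) (hn : 1 ≤ n) (f : (Fin n → Bool) → Bool) :
    Nat.card (Set.range (fun x₀ : Fin n → Bool => outF n hn f x₀)) = 2 ^ n := by
  rw [Nat.card_range_of_injective (outF_injective n hn f)]
  simp
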